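/- For every n ≥ 1, the sorting class of the \underline{12}3-avoiding stack-sorting map satisfies |Sort_n(sc_{\underline{12}3})| = C_{n−1} + Σ_{i=0}^{n−2} 2^{n−2−i}·C_i, where C_i is the i-th Catalan number. -/

import Mathlib

/-- `τ` contains the vincular pattern with entries `σ` and adjacency-constraint set `A`:
there is an occurrence of the classical pattern `σ` in `τ` (a strictly increasing choice of
positions carrying entries order-isomorphic to `σ`) such that for every `a ∈ A`, the
occurrence positions corresponding to entries `a` and `a + 1` of `σ` are adjacent in `τ`.
Classical patterns correspond to `A = ∅`. -/
def ContainsV (σ : List ℕ) (A : Set ℕ) (τ : List ℕ) : Prop :=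
  ∃ f : Fin σ.length → Fin τ.length,
    StrictMono f ∧
    (∀ a b : Fin σ.length, σ.get a < σ.get b ↔ τ.get (f a) < τ.get (f b)) ∧
    ∀ a : ℕ, a ∈ A → ∀ h : a + 1 < σ.length,
      (f ⟨a + 1, h⟩ : ℕ) = (f ⟨a, Nat.lt_of_succ_lt h⟩ : ℕ) + 1

open Classical in
/-- The `σ`-avoiding stack pass: `scAux σ A stack input` where the stack is recorded
top-to-bottom; the next input element is pushed when the stack contents together with the
new element on top avoid the vincular pattern `(σ, A)`, and otherwise the top of the stack
is popped to the output; at the end the remaining stack entries are popped to the output. -/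
noncomputable def scAux (σ : List ℕ) (A : Set ℕ) : List ℕ → List ℕ → List ℕ
  | stack, [] => stack
  | [], x :: rest => scAux σ A [x] rest
  | y :: stack', x :: rest =>
    if ContainsV σ A (x :: y :: stack') then
      y :: scAux σ A stack' (x :: rest)
    else
      scAux σ A (x :: y :: stack') rest
termination_by stack input => stack.length + 2 * input.length
decreasing_by all_goals (simp only [List.length_cons, List.length_nil]; omega)

/-- The `(σ, A)`-avoiding stack-sorting map `sc_{(σ, A)}`. -/
noncomputable def sc (σ : List ℕ) (A : Set ℕ) (τ : List ℕ) : List ℕ :=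
  scAux σ A [] τ

/-- `τ` is (the one-line notation of) a permutation of `{1, …, n}`. -/
def IsPermList (n : ℕ) (τ : List ℕ) : Prop :=
  τ.Perm (List.range' 1 n)

/-- The sorting class `Sort_n(sc_{(σ, A)})`: permutations of length `n` whose image under
`sc_{(σ, A)}` avoids the classical pattern `231`. -/
def SortSet (σ : List ℕ) (A : Set ℕ) (n : ℕ) : Set (List ℕ) :=
  {τ | IsPermList n τ ∧ ¬ ContainsV [2, 3, 1] ∅ (sc σ A τ)}


namespace SC
open List

def push (x : ℕ) : List ℕ → List ℕ × List ℕ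
  | [] => ([], [x])
  | y :: S => if x < y ∧ ∃ z ∈ S, y < z then (y :: (push x S).1, (push x S).2)
      else ([], x :: y :: S)

def run : List ℕ → List ℕ → List ℕ × List ℕ
  | S, [] => ([], S)
  | S, x :: r => ((push x S).1 ++ (run (push x S).2 r).1, (run (push x S).2 r).2)

def push2 (x : ℕ) : List ℕ → List ℕ × List ℕ
  | [] => ([], [x])
  | y :: S => if x < y then (y :: (push2 x S).1, (push2 x S).2) else ([], x :: y :: S)

def run2 : List ℕ → List ℕ → List ℕ × List ℕ
  | S, [] => ([], S)
  | S, x :: r => ((push2 x S).1 ++ (run2 (push2 x S).2 r).1, (run2 (push2 x S).2 r).2)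

def s2 (B : List ℕ) : List ℕ := (run2 [] B).1 ++ (run2 [] B).2

def Av (τ : List ℕ) : Prop := ∀ x y z, [x, y, z] <+ τ → ¬ (z < x ∧ x < y)

/-! ### bridge -/

lemma contains231 (τ : List ℕ) : ContainsV [2, 3, 1] ∅ τ ↔ ¬ Av τ := by
  unfold Av ContainsV
  push Not
  constructor
  · rintro ⟨f, hf, h, -⟩
    refine ⟨τ.get (f 0), τ.get (f 1), τ.get (f 2), ?_, ?_, ?_⟩
    · rw [List.sublist_iff_exists_fin_orderEmbedding_get_eq]
      refine ⟨OrderEmbedding.ofStrictMono f hf, ?_⟩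
      intro ix
      fin_cases ix <;> rfl
    · exact (h 2 0).1 (by simp)
    · exact (h 0 1).1 (by simp)
  · rintro ⟨x, y, z, hs, h1, h2⟩
    rw [List.sublist_iff_exists_fin_orderEmbedding_get_eq] at hs
    obtain ⟨f, hf⟩ := hs
    refine ⟨f, f.strictMono, ?_, by simp⟩
    have e0 : τ.get (f 0) = x := (hf 0).symm
    have e1 : τ.get (f 1) = y := (hf 1).symm
    have e2 : τ.get (f 2) = z := (hf 2).symm
    intro a b
    fin_cases a <;> fin_cases b <;> simp <;> simp at e0 e1 e2 <;> omega

def V (τ : List ℕ) : Prop := ∃ i k, ∃ (h : i + 1 < k) (hk : k < τ.length),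
  τ[i] < τ[i+1] ∧ τ[i+1] < τ[k]

lemma contains123 (τ : List ℕ) : ContainsV [1, 2, 3] {0} τ ↔ V τ := by
  unfold V ContainsV
  constructor
  · rintro ⟨f, hf, h, h2⟩
    have a1 := h2 0 rfl (by simp)
    have l1 : f 0 < f 1 := hf (by decide)
    have l2 : f 1 < f 2 := hf (by decide)
    have b1 := (h 0 1).1 (by simp)
    have b2 := (h 1 2).1 (by simp)
    have a2 : (f 1 : ℕ) = f 0 + 1 := a1
    refine ⟨f 0, f 2, ?_, (f 2).2, ?_, ?_⟩
    · omega
    · simpa [a2] using b1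
    · simpa [a2] using b2
  · rintro ⟨i, k, h, hk, h1, h2⟩
    refine ⟨![⟨i, by omega⟩, ⟨i+1, by omega⟩, ⟨k, hk⟩], ?_, ?_, ?_⟩
    · intro a b hab
      fin_cases a <;> fin_cases b <;> simp at hab ⊢ <;> omega
    · intro a b
      fin_cases a <;> fin_cases b <;> simp <;> omega
    · intro a ha hh
      obtain rfl : a = 0 := ha
      rfl

lemma V_cons (x y : ℕ) (S : List ℕ) :
    V (x :: y :: S) ↔ (x < y ∧ ∃ z ∈ S, y < z) ∨ V (y :: S) := by
  unfold V
  constructor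
  · rintro ⟨i, k, h, hk, h1, h2⟩
    obtain ⟨k, rfl⟩ : ∃ k', k = k' + 2 := ⟨k - 2, by omega⟩
    rcases i with _ | i
    · left
      simp at h1 h2 hk
      exact ⟨h1, _, List.getElem_mem _, h2⟩
    · right
      refine ⟨i, k + 1, by omega, by simpa using hk, by simpa using h1, by simpa using h2⟩
  · rintro (⟨h, z, hz, h2⟩ | ⟨i, k, h, hk, h1, h2⟩)
    · obtain ⟨k, hk, rfl⟩ := List.mem_iff_getElem.1 hz
      exact ⟨0, k + 2, by omega, by simpa using hk, by simpa using h, by simpa using h2⟩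
    · refine ⟨i + 1, k + 1, by omega, by simpa using hk, by simpa using h1, by simpa using h2⟩

lemma V_nil : ¬ V [] := by rintro ⟨i, k, h, hk, -⟩; simp at hk
lemma V_one (x : ℕ) : ¬ V [x] := by rintro ⟨i, k, h, hk, -⟩; simp at hk; omega

lemma V_tail (y : ℕ) (S : List ℕ) (h : ¬ V (y :: S)) : ¬ V S := by
  cases S with
  | nil => exact V_nil
  | cons z S => rw [V_cons] at h; tauto

lemma scAux_push (x : ℕ) (r : List ℕ) (S : List ℕ) (h : ¬ V S) :
    scAux [1,2,3] {0} S (x :: r) =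
      (push x S).1 ++ scAux [1,2,3] {0} (push x S).2 r ∧ ¬ V (push x S).2 := by
  induction S with
  | nil => simp [scAux, push, V_one]
  | cons y S ih =>
    rw [scAux, contains123]
    have e : V (x :: y :: S) ↔ (x < y ∧ ∃ z ∈ S, y < z) := by rw [V_cons, or_iff_left h]
    rw [push]
    by_cases c : x < y ∧ ∃ z ∈ S, y < z
    · rw [if_pos (e.2 c), if_pos c]
      have := ih (V_tail _ _ h)
      simp [this]
    · rw [if_neg (fun h => c (e.1 h)), if_neg c]
      simp [e, c]

lemma scAux_run (r : List ℕ) (S : List ℕ) (h : ¬ V S) :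
    scAux [1,2,3] {0} S r = (run S r).1 ++ (run S r).2 := by
  induction r generalizing S with
  | nil => cases S <;> simp [scAux, run]
  | cons x r ih =>
    have := scAux_push x r S h
    rw [this.1, ih _ this.2]
    simp [run]

lemma sc_eq (τ : List ℕ) : sc [1,2,3] {0} τ = (run [] τ).1 ++ (run [] τ).2 :=
  scAux_run τ [] V_nil

/-! ### facts on run -/

lemma run_append (S L R : List ℕ) : run S (L ++ R) =
    ((run S L).1 ++ (run (run S L).2 R).1, (run (run S L).2 R).2) := by
  induction L generalizing S with
  | nil => simp [run]
  | cons x L ih => simp [run, ih]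

lemma run2_append (S L R : List ℕ) : run2 S (L ++ R) =
    ((run2 S L).1 ++ (run2 (run2 S L).2 R).1, (run2 (run2 S L).2 R).2) := by
  induction L generalizing S with
  | nil => simp [run2]
  | cons x L ih => simp [run2, ih]

lemma push_perm (x : ℕ) (S : List ℕ) : (push x S).1 ++ (push x S).2 ~ x :: S := by
  induction S with
  | nil => simp [push]
  | cons y S ih =>
    rw [push]; split_ifs
    · exact (ih.cons y).trans (List.Perm.swap _ _ _)
    · simp

lemma push2_perm (x : ℕ) (S : List ℕ) : (push2 x S).1 ++ (push2 x S).2 ~ x :: S := by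
  induction S with
  | nil => simp [push2]
  | cons y S ih =>
    rw [push2]; split_ifs
    · exact (ih.cons y).trans (List.Perm.swap _ _ _)
    · simp

lemma run_perm (S L : List ℕ) : (run S L).1 ++ (run S L).2 ~ S ++ L := by
  induction L generalizing S with
  | nil => simp [run]
  | cons x L ih =>
    simp only [run, List.append_assoc]
    refine ((ih _).append_left _).trans ?_
    rw [← List.append_assoc]
    exact ((push_perm x S).append_right L).trans List.perm_middle.symm

lemma run2_perm (S L : List ℕ) : (run2 S L).1 ++ (run2 S L).2 ~ S ++ L := by
  induction L generalizing S with
  | nil => simp [run2]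
  | cons x L ih =>
    simp only [run2, List.append_assoc]
    refine ((ih _).append_left _).trans ?_
    rw [← List.append_assoc]
    exact ((push2_perm x S).append_right L).trans List.perm_middle.symm

lemma s2_perm (L : List ℕ) : s2 L ~ L := run2_perm [] L

lemma push_low (x : ℕ) (S : List ℕ) : x ∈ (push x S).2 ∧ ∀ o ∈ S, ∃ s ∈ (push x S).2, s ≤ o := by
  induction S with
  | nil => simp [push]
  | cons y S ih =>
    rw [push]; split_ifs with h
    · refine ⟨ih.1, fun o ho => ?_⟩
      rcases List.mem_cons.1 ho with rfl | ho
      · exact ⟨x, ih.1, h.1.le⟩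
      · exact ih.2 o ho
    · refine ⟨by simp, fun o ho => ⟨o, ?_, le_rfl⟩⟩
      exact List.mem_cons_of_mem _ ho

lemma run_low (S L : List ℕ) : ∀ o ∈ S ++ L, ∃ s ∈ (run S L).2, s ≤ o := by
  induction L generalizing S with
  | nil => simp only [run, List.append_nil]; exact fun o ho => ⟨o, ho, le_rfl⟩
  | cons x L ih =>
    intro o ho
    simp only [run]
    have := push_low x S
    simp only [List.mem_append, List.mem_cons] at ho ih
    rcases ho with ho | rfl | ho
    · obtain ⟨s, hs, hso⟩ := this.2 o ho
      obtain ⟨t, ht, hts⟩ := ih _ s (Or.inl hs)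
      exact ⟨t, ht, hts.trans hso⟩
    · exact ih _ _ (Or.inl this.1)
    · exact ih _ _ (Or.inr ho)

lemma push_max (m : ℕ) (S : List ℕ) (h : ∀ s ∈ S, s < m) : push m S = ([], m :: S) := by
  cases S with
  | nil => rfl
  | cons y S =>
    rw [push, if_neg]
    have := h y (by simp)
    omega

lemma push_over (x m : ℕ) (T S : List ℕ) (hx : x < m) (hT : ∀ t ∈ T, t < m)
    (hS : ∀ s ∈ S, s < m) :
    push x (T ++ m :: S) = ((push2 x T).1, (push2 x T).2 ++ m :: S) := by
  induction T with
  | nil =>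
    have : ¬ ∃ z ∈ S, m < z := by rintro ⟨z, hz, h⟩; have := hS z hz; omega
    simp [push, push2, this]
  | cons y T ih =>
    have h0 : ∃ z ∈ T ++ m :: S, y < z := ⟨m, by simp, hT y (by simp)⟩
    simp only [List.cons_append, push, push2, h0, and_true]
    rw [ih (fun t ht => hT t (by simp [ht]))]
    split_ifs <;> simp

lemma run_over (m : ℕ) (T S R : List ℕ) (hR : ∀ x ∈ R, x < m) (hT : ∀ t ∈ T, t < m)
    (hS : ∀ s ∈ S, s < m) :
    run (T ++ m :: S) R = ((run2 T R).1, (run2 T R).2 ++ m :: S) := by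
  induction R generalizing T with
  | nil => simp [run, run2]
  | cons x R ih =>
    have hx : x < m := hR x (by simp)
    simp only [run, run2, push_over x m T S hx hT hS]
    rw [ih]
    · exact fun x hx => hR x (by simp [hx])
    · intro t ht
      have := (push2_perm x T).mem_iff.1 (List.mem_append_right _ ht)
      rcases List.mem_cons.1 this with rfl | h
      · exact hx
      · exact hT t h

lemma run_split (m : ℕ) (L R : List ℕ) (hL : ∀ x ∈ L, x < m) (hR : ∀ x ∈ R, x < m) :
    run [] (L ++ m :: R) = ((run [] L).1 ++ (run2 [] R).1, (run2 [] R).2 ++ m :: (run [] L).2) := by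
  have hS : ∀ s ∈ (run [] L).2, s < m := fun s hs =>
    hL s (by simpa using (run_perm [] L).mem_iff.1 (List.mem_append_right _ hs))
  rw [run_append]
  simp only [run, push_max m _ hS]
  have := run_over m [] (run [] L).2 R hR (by simp) hS
  simp only [List.nil_append] at this
  simp [this]

lemma push2_min (a : ℕ) (S : List ℕ) (h : ∀ s ∈ S, a < s) : push2 a S = (S, [a]) := by
  induction S with
  | nil => rfl
  | cons y S ih =>
    rw [push2, if_pos (h y (by simp)), ih (fun s hs => h s (by simp [hs]))]

lemma push2_over (x a : ℕ) (T : List ℕ) (hx : a < x) :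
    push2 x (T ++ [a]) = ((push2 x T).1, (push2 x T).2 ++ [a]) := by
  induction T with
  | nil => simp [push2]; omega
  | cons y T ih =>
    simp only [List.cons_append, push2]
    rw [ih]
    split_ifs <;> simp

lemma run2_over (a : ℕ) (T R : List ℕ) (hR : ∀ x ∈ R, a < x) :
    run2 (T ++ [a]) R = ((run2 T R).1, (run2 T R).2 ++ [a]) := by
  induction R generalizing T with
  | nil => simp [run2]
  | cons x R ih =>
    simp only [run2, push2_over x a T (hR x (by simp))]
    rw [ih _ (fun x hx => hR x (by simp [hx]))]

lemma s2_split (a : ℕ) (L R : List ℕ) (hL : ∀ x ∈ L, a < x) (hR : ∀ x ∈ R, a < x) :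
    s2 (L ++ a :: R) = s2 L ++ s2 R ++ [a] := by
  have hS : ∀ s ∈ (run2 [] L).2, a < s := fun s hs =>
    hL s (by simpa using (run2_perm [] L).mem_iff.1 (List.mem_append_right _ hs))
  have := run2_over a [] R hR
  simp only [List.nil_append] at this
  simp [s2, run2_append, run2, push2_min a _ hS, this]

lemma push2_nil_iff (x : ℕ) (T : List ℕ) (hT : T.Pairwise (· ≥ ·)) :
    (push2 x T).1 = [] ↔ (x :: T).Pairwise (· ≥ ·) := by
  cases T with
  | nil => simp [push2]
  | cons y T =>
    rw [push2]
    have := List.pairwise_cons.1 hT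
    split_ifs with h
    · simp; intro h'; omega
    · simp only [true_iff]
      refine List.pairwise_cons.2 ⟨?_, hT⟩
      intro t ht
      rcases List.mem_cons.1 ht with rfl | ht
      · omega
      · have := this.1 t ht; omega

lemma push2_nil (x : ℕ) (T : List ℕ) (h : (push2 x T).1 = []) : (push2 x T).2 = x :: T := by
  cases T with
  | nil => rfl
  | cons y T => rw [push2] at h ⊢; split_ifs at h ⊢; rfl

lemma run2_nil (T R : List ℕ) (h : (run2 T R).1 = []) : (run2 T R).2 = R.reverse ++ T := by
  induction R generalizing T with
  | nil => simp [run2]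
  | cons x R ih =>
    simp only [run2, List.append_eq_nil_iff] at h ⊢
    rw [ih _ h.2, push2_nil _ _ h.1]; simp

lemma run2_nil_iff (T R : List ℕ) (hT : T.Pairwise (· ≥ ·)) :
    (run2 T R).1 = [] ↔ (R.reverse ++ T).Pairwise (· ≥ ·) := by
  induction R generalizing T with
  | nil => simp [run2, hT]
  | cons x R ih =>
    simp only [run2, List.append_eq_nil_iff, List.reverse_cons, List.append_assoc]
    constructor
    · rintro ⟨h1, h2⟩
      have h3 := (push2_nil_iff x T hT).1 h1
      rw [push2_nil _ _ h1] at h2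
      simpa using (ih _ h3).1 h2
    · intro h
      have h3 : (x :: T).Pairwise (· ≥ ·) := h.sublist (by simp)
      have h1 := (push2_nil_iff x T hT).2 h3
      refine ⟨h1, ?_⟩
      rw [push2_nil _ _ h1]
      exact (ih _ h3).2 (by simpa using h)

/-! ### Av -/

lemma Av.sub {A B : List ℕ} (h : Av B) (hs : A <+ B) : Av A :=
  fun x y z h' => h x y z (h'.trans hs)

lemma Av_of_pairwise {A : List ℕ} (h : A.Pairwise (· ≥ ·)) : Av A := by
  intro x y z hs
  have := h.sublist hs
  simp at this
  omega

lemma Av_split (M : ℕ) (A S : List ℕ) (hA : ∀ a ∈ A, a < M) (hS : ∀ s ∈ S, s < M)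
    (hne : ∀ a ∈ A, ∀ s ∈ S, a ≠ s) :
    Av (A ++ M :: S) ↔ (∀ a ∈ A, ∀ s ∈ S, a < s) ∧ Av A ∧ Av S := by
  constructor
  · intro h
    refine ⟨fun a ha s hs => ?_, h.sub (by simp), h.sub (by simp)⟩
    have : [a, M, s] <+ A ++ M :: S := by
      have h1 : [a] <+ A := List.singleton_sublist.2 ha
      have h2 : [s] <+ S := List.singleton_sublist.2 hs
      exact h1.append (h2.cons_cons M)
    have h3 := h _ _ _ this
    have := hne a ha s hs
    have := hA a ha
    omega
  · rintro ⟨h, h1, h2⟩ x y z hs ⟨c1, c2⟩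
    obtain ⟨l1, l2, e, s1, s2⟩ := List.sublist_append_iff.1 hs
    have hle : ∀ u ∈ M :: S, u ≤ M := by
      intro u hu; rcases List.mem_cons.1 hu with rfl | hu
      · rfl
      · exact (hS u hu).le
    have hz : ∀ u ∈ A, z ∈ M :: S → z < u → False := by
      intro u hu hzz hlt
      rcases List.mem_cons.1 hzz with rfl | hz
      · have := hA u hu; omega
      · have := h u hu z hz; omega
    rcases l1 with _ | ⟨u, _ | ⟨v, _ | ⟨w, l1⟩⟩⟩ <;> simp at e
    · subst e
      have hy : y ≤ M := hle y (s2.subset (by simp))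
      cases s2 with
      | cons _ h' => exact h2 _ _ _ h' ⟨c1, c2⟩
      | cons_cons _ h' => omega
    · obtain ⟨rfl, rfl⟩ := e
      exact hz x (s1.subset (by simp)) (s2.subset (by simp)) c1
    · obtain ⟨rfl, rfl, rfl⟩ := e
      exact hz x (s1.subset (by simp)) (s2.subset (by simp)) c1
    · obtain ⟨rfl, rfl, rfl, rfl, rfl⟩ := e
      exact h1 _ _ _ s1 ⟨c1, c2⟩

/-! ### perms of intervals -/

lemma perm_split (a n : ℕ) (L R : List ℕ) (h : L ++ R ~ List.range' a n)
    (hlt : ∀ r ∈ R, ∀ l ∈ L, r < l) :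
    ∃ j ≤ n, R ~ List.range' a j ∧ L ~ List.range' (a + j) (n - j) := by
  have hlen : L.length + R.length = n := by simpa using h.length_eq
  have hp : R.insertionSort (· ≤ ·) ++ L.insertionSort (· ≤ ·) ~ List.range' a n :=
    ((List.perm_insertionSort _ R).append (List.perm_insertionSort _ L)).trans
      (List.perm_append_comm.trans h)
  have he : R.insertionSort (· ≤ ·) ++ L.insertionSort (· ≤ ·) = List.range' a n := by
    refine List.Perm.eq_of_pairwise (le := (· ≤ ·)) (fun _ _ _ _ => le_antisymm) ?_ ?_ hp
    · rw [List.pairwise_append]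
      refine ⟨List.pairwise_insertionSort _ _, List.pairwise_insertionSort _ _, ?_⟩
      intro r hr l hl
      exact (hlt r ((List.mem_insertionSort _).1 hr) l ((List.mem_insertionSort _).1 hl)).le
    · exact (List.pairwise_lt_range' ).imp le_of_lt
  have hsp : List.range' a n = List.range' a R.length ++ List.range' (a + R.length) (n - R.length) := by
    rw [List.range'_append_1]; congr 1; omega
  rw [hsp] at he
  obtain ⟨h1, h2⟩ := List.append_inj he (by simp)
  refine ⟨R.length, by omega, ?_, ?_⟩
  · rw [← h1]; exact (List.perm_insertionSort _ R).symm
  · rw [← h2]; exact (List.perm_insertionSort _ L).symm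

lemma perm_join (a n j : ℕ) (hj : j ≤ n) (L R : List ℕ) (hR : R ~ List.range' a j)
    (hL : L ~ List.range' (a + j) (n - j)) :
    L ++ R ~ List.range' a n ∧ ∀ r ∈ R, ∀ l ∈ L, r < l := by
  constructor
  · refine List.perm_append_comm.trans ((hR.append hL).trans ?_)
    rw [List.range'_append_1]
    rw [show j + (n - j) = n by omega]
  · intro r hr l hl
    have h1 := hR.mem_iff.1 hr
    have h2 := hL.mem_iff.1 hl
    simp only [List.mem_range'_1] at h1 h2
    omega

/-! ### counting -/

lemma fin_perm (a n : ℕ) (p : List ℕ → Prop) :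
    {τ : List ℕ | τ ~ List.range' a n ∧ p τ}.Finite := by
  refine Set.Finite.subset (List.finite_toSet (List.range' a n).permutations) ?_
  rintro τ ⟨h, -⟩
  simpa using h

lemma count (F : Set (List ℕ)) (X Y : ℕ → Set (List ℕ)) (n m : ℕ)
    (hX : ∀ j, (X j).Finite) (hY : ∀ j, (Y j).Finite)
    (hlen : ∀ j, ∀ R ∈ Y j, R.length = j)
    (hm : ∀ j ≤ n, ∀ L ∈ X j, m ∉ L) (hm2 : ∀ j ≤ n, ∀ R ∈ Y j, m ∉ R)
    (h : ∀ τ, τ ∈ F ↔ ∃ j ≤ n, ∃ L ∈ X j, ∃ R ∈ Y j, τ = L ++ m :: R) :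
    F.ncard = ∑ j ∈ Finset.range (n + 1), (X j).ncard * (Y j).ncard := by
  classical
  have inj : ∀ j ≤ n, ∀ j' ≤ n, ∀ L ∈ X j, ∀ L' ∈ X j', ∀ R ∈ Y j, ∀ R' ∈ Y j',
      L ++ m :: R = L' ++ m :: R' → L = L' ∧ R = R' := by
    intro j hj j' hj' L hL L' hL' R hR R' hR' e
    have h1 := hm j hj L hL
    have h2 := hm j' hj' L' hL'
    have e1 : (L ++ m :: R).idxOf m = L.length := by
      rw [List.idxOf_append_of_notMem h1]; simp
    have e2 : (L' ++ m :: R').idxOf m = L'.length := by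
      rw [List.idxOf_append_of_notMem h2]; simp
    have e3 : L.length = L'.length := by rw [← e1, ← e2, e]
    have := List.append_inj e e3
    simpa using this
  let G : ℕ → Finset (List ℕ) := fun j =>
    ((hX j).toFinset ×ˢ (hY j).toFinset).image (fun p => p.1 ++ m :: p.2)
  have hF : F = ↑((Finset.range (n + 1)).biUnion G) := by
    ext τ
    rw [h]
    simp only [G, Finset.coe_biUnion, Finset.coe_range, Set.mem_Iio, Set.mem_iUnion,
      Finset.coe_image, Set.mem_image, Finset.mem_coe, Finset.mem_product, Set.Finite.mem_toFinset,
      Prod.exists]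
    constructor
    · rintro ⟨j, hj, L, hL, R, hR, rfl⟩
      exact ⟨j, by omega, L, R, ⟨hL, hR⟩, rfl⟩
    · rintro ⟨j, hj, L, R, ⟨hL, hR⟩, rfl⟩
      exact ⟨j, by omega, L, hL, R, hR, rfl⟩
  rw [hF, Set.ncard_coe_finset, Finset.card_biUnion]
  · refine Finset.sum_congr rfl fun j hj => ?_
    have hj : j ≤ n := by simpa [Nat.lt_succ_iff] using hj
    rw [Finset.card_image_of_injOn, Finset.card_product, Set.ncard_eq_toFinset_card _ (hX j),
      Set.ncard_eq_toFinset_card _ (hY j)]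
    rintro ⟨L, R⟩ h1 ⟨L', R'⟩ h2 e
    simp at h1 h2
    have := inj j hj j hj L h1.1 L' h2.1 R h1.2 R' h2.2 e
    simp [this]
  · intro j hj j' hj' hne
    have hj : j ≤ n := by simpa [Nat.lt_succ_iff] using hj
    have hj' : j' ≤ n := by simpa [Nat.lt_succ_iff] using hj'
    rw [Function.onFun, Finset.disjoint_left]
    intro τ h1 h2
    simp only [G, Finset.mem_image, Finset.mem_product, Set.Finite.mem_toFinset, Prod.exists] at h1 h2
    obtain ⟨L, R, ⟨hL, hR⟩, rfl⟩ := h1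
    obtain ⟨L', R', ⟨hL', hR'⟩, e⟩ := h2
    have := inj j' hj' j hj L' hL' L hL R' hR' R hR e
    apply hne
    rw [← hlen j R hR, ← hlen j' R' hR', this.2]

def D (a n : ℕ) : Set (List ℕ) := {τ | τ ~ List.range' a n ∧ (s2 τ).Pairwise (· > ·)}
def I (a n : ℕ) : Set (List ℕ) := {τ | τ ~ List.range' a n ∧ (run2 [] τ).1 = []}
def X (a n : ℕ) : Set (List ℕ) :=
  {τ | τ ~ List.range' a n ∧ ((run [] τ).1 = [] ∧ Av (run [] τ).2)}

lemma I_eq (a n : ℕ) : I a n = {List.range' a n} := by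
  ext τ
  simp only [I, Set.mem_setOf_eq, Set.mem_singleton_iff]
  rw [run2_nil_iff _ _ (by simp)]
  simp only [List.append_nil, List.pairwise_reverse]
  have hr : (List.range' a n).Pairwise (fun a b => b ≥ a) := (List.pairwise_lt_range').imp le_of_lt
  constructor
  · rintro ⟨h, hp⟩
    exact List.Perm.eq_of_pairwise (le := (· ≤ ·)) (fun _ _ _ _ => le_antisymm) hp hr h
  · rintro rfl
    exact ⟨.rfl, hr⟩

/-- perm splitting at the minimum / maximum -/
lemma mid_min {a n : ℕ} {L R : List ℕ} :
    L ++ a :: R ~ List.range' a (n + 1) ↔ L ++ R ~ List.range' (a + 1) n := by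
  rw [List.range'_succ]
  exact ⟨fun h => (List.perm_cons a).1 (List.perm_middle.symm.trans h),
    fun h => List.perm_middle.trans (h.cons a)⟩

lemma mid_max {a n : ℕ} {L R : List ℕ} :
    L ++ (a + n) :: R ~ List.range' a (n + 1) ↔ L ++ R ~ List.range' a n := by
  have : List.range' a (n + 1) ~ (a + n) :: List.range' a n := by
    rw [List.range'_1_concat]
    exact List.perm_append_singleton _ _
  exact ⟨fun h => (List.perm_cons (a + n)).1 (List.perm_middle.symm.trans (h.trans this)),
    fun h => List.perm_middle.trans ((h.cons _).trans this.symm)⟩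

lemma D_rec (a n : ℕ) (τ : List ℕ) : τ ∈ D a (n + 1) ↔
    ∃ j ≤ n, ∃ L ∈ D (a + 1 + j) (n - j), ∃ R ∈ D (a + 1) j, τ = L ++ a :: R := by
  have key : ∀ L R : List ℕ, L ++ R ~ List.range' (a + 1) n →
      s2 (L ++ a :: R) = s2 L ++ s2 R ++ [a] ∧ ∀ x ∈ L ++ R, a < x := by
    intro L R h
    have h0 : ∀ x ∈ L ++ R, a < x := by
      intro x hx
      have := h.mem_iff.1 hx
      simp only [List.mem_range'_1] at this
      omega
    exact ⟨s2_split a L R (fun x hx => h0 x (by simp [hx])) (fun x hx => h0 x (by simp [hx])), h0⟩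
  constructor
  · rintro ⟨h, hp⟩
    obtain ⟨L, R, rfl⟩ := List.append_of_mem (h.mem_iff.2 (by simp) : a ∈ τ)
    rw [mid_min] at h
    rw [(key L R h).1] at hp
    have hp1 := (List.pairwise_append.1 hp).1
    have hp2 := List.pairwise_append.1 hp1
    obtain ⟨j, hj, hR, hL⟩ := perm_split _ _ L R h (fun r hr l hl =>
      hp2.2.2 l ((s2_perm L).mem_iff.2 hl) r ((s2_perm R).mem_iff.2 hr))
    exact ⟨j, hj, L, ⟨hL, hp2.1⟩, R, ⟨hR, hp2.2.1⟩, rfl⟩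
  · rintro ⟨j, hj, L, ⟨hL, hL2⟩, R, ⟨hR, hR2⟩, rfl⟩
    obtain ⟨h, hlt⟩ := perm_join (a + 1) n j hj L R hR hL
    refine ⟨mid_min.2 h, ?_⟩
    obtain ⟨k1, k2⟩ := key L R h
    rw [k1, List.pairwise_append, List.pairwise_append]
    refine ⟨⟨hL2, hR2, ?_⟩, by simp, ?_⟩
    · intro l hl r hr
      exact hlt r ((s2_perm R).mem_iff.1 hr) l ((s2_perm L).mem_iff.1 hl)
    · intro x hx y hy
      obtain rfl : y = a := by simpa using hy
      exact k2 x (((s2_perm L).append (s2_perm R)).mem_iff.1 hx)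

lemma notMem_of (m a n : ℕ) (L : List ℕ) (h : L ~ List.range' a n) (hm : m < a ∨ a + n ≤ m) :
    m ∉ L := by
  intro hx
  have := h.mem_iff.1 hx
  simp only [List.mem_range'_1] at this
  omega

lemma D_card (n : ℕ) : ∀ a, (D a n).ncard = catalan n := by
  induction n using Nat.strong_induction_on with
  | _ n ih =>
    intro a
    rcases n with _ | n
    · have : D a 0 = {[]} := by
        ext τ; simp only [D, List.range'_zero, List.perm_nil, Set.mem_setOf_eq, Set.mem_singleton_iff]
        constructor
        · exact fun h => h.1
        · rintro rfl; simp [s2, run2]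
      simp [this]
    · rw [count (D a (n + 1)) (fun j => D (a + 1 + j) (n - j)) (fun j => D (a + 1) j) n a
        (fun j => fin_perm _ _ _) (fun j => fin_perm _ _ _)
        (fun j R hR => by simpa using hR.1.length_eq)
        (fun j hj L hL => notMem_of _ _ _ _ hL.1 (by omega))
        (fun j hj L hL => notMem_of _ _ _ _ hL.1 (by omega)) (D_rec a n)]
      rw [catalan_succ, Finset.sum_range]
      refine Finset.sum_congr rfl fun j _ => ?_
      rw [ih (n - j) (by omega), ih j (by omega), mul_comm]

/-- common part -/
lemma max_key {a n : ℕ} {L R : List ℕ} (h : L ++ R ~ List.range' a n) :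
    (∀ x ∈ L, x < a + n) ∧ (∀ x ∈ R, x < a + n) ∧ (∀ l ∈ L, ∀ r ∈ R, l ≠ r) := by
  refine ⟨fun x hx => ?_, fun x hx => ?_, ?_⟩
  · have := h.mem_iff.1 (List.mem_append_left _ hx)
    simp only [List.mem_range'_1] at this
    omega
  · have := h.mem_iff.1 (List.mem_append_right _ hx)
    simp only [List.mem_range'_1] at this
    omega
  · have : (L ++ R).Nodup := h.nodup_iff.2 (List.nodup_range')
    intro l hl r hr e
    exact (List.nodup_append.1 this).2.2 l hl r hr e

lemma run_nil_perm {L : List ℕ} (h : (run [] L).1 = []) : (run [] L).2 ~ L := by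
  have := run_perm [] L
  simpa [h] using this

lemma X_rec (a n : ℕ) (τ : List ℕ) : τ ∈ X a (n + 1) ↔
    ∃ j ≤ n, ∃ L ∈ X (a + j) (n - j), ∃ R ∈ I a j, τ = L ++ (a + n) :: R := by
  constructor
  · rintro ⟨h, hp, hav⟩
    obtain ⟨L, R, rfl⟩ := List.append_of_mem (h.mem_iff.2 (by simp) : (a + n) ∈ τ)
    rw [mid_max] at h
    obtain ⟨k1, k2, k3⟩ := max_key h
    rw [run_split _ _ _ k1 k2] at hp hav
    simp only [List.append_eq_nil_iff] at hp
    have pL := run_nil_perm hp.1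
    have eR := run2_nil _ _ hp.2
    simp only [List.append_nil] at eR
    simp only [eR] at hav
    rw [Av_split _ _ _ (by simpa using k2) (fun s hs => k1 s (pL.mem_iff.1 hs))
      (fun r hr l hl => (k3 l (pL.mem_iff.1 hl) r (by simpa using hr)).symm)] at hav
    obtain ⟨j, hj, hR, hL⟩ := perm_split _ _ L R h (fun r hr l hl =>
      hav.1 r (by simpa using hr) l (pL.mem_iff.2 hl))
    exact ⟨j, hj, L, ⟨hL, hp.1, hav.2.2⟩, R, ⟨hR, hp.2⟩, rfl⟩
  · rintro ⟨j, hj, L, ⟨hL, hL2, hL3⟩, R, ⟨hR, hR2⟩, rfl⟩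
    obtain ⟨h, hlt⟩ := perm_join a n j hj L R hR hL
    refine ⟨mid_max.2 h, ?_⟩
    obtain ⟨k1, k2, k3⟩ := max_key h
    have pL := run_nil_perm hL2
    have eR := run2_nil _ _ hR2
    have sR := (run2_nil_iff [] R (by simp)).1 hR2
    simp only [List.append_nil] at eR sR
    rw [run_split _ _ _ k1 k2]
    refine ⟨by simp [hL2, hR2], ?_⟩
    simp only [eR]
    rw [Av_split _ _ _ (by simpa using k2) (fun s hs => k1 s (pL.mem_iff.1 hs))
      (fun r hr l hl => (k3 l (pL.mem_iff.1 hl) r (by simpa using hr)).symm)]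
    exact ⟨fun r hr l hl => hlt r (by simpa using hr) l (pL.mem_iff.1 hl), Av_of_pairwise sR, hL3⟩

lemma X_card0 (a : ℕ) : (X a 0).ncard = 1 := by
  have : X a 0 = {[]} := by
    ext τ; simp only [X, List.range'_zero, List.perm_nil, Set.mem_setOf_eq, Set.mem_singleton_iff]
    constructor
    · exact fun h => h.1
    · rintro rfl; simp [run, Av]
  simp [this]

lemma X_card_rec (a n : ℕ) :
    (X a (n + 1)).ncard = ∑ j ∈ Finset.range (n + 1), (X (a + j) (n - j)).ncard := by
  rw [count (X a (n + 1)) (fun j => X (a + j) (n - j)) (fun j => I a j) n (a + n)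
        (fun j => fin_perm _ _ _) (fun j => fin_perm _ _ _)
        (fun j R hR => by simpa using hR.1.length_eq)
        (fun j hj L hL => notMem_of _ _ _ _ hL.1 (by omega))
        (fun j hj L hL => notMem_of _ _ _ _ hL.1 (by omega)) (X_rec a n)]
  simp [I_eq]

lemma X_card (n : ℕ) : ∀ a, (X a (n + 1)).ncard = 2 ^ n := by
  induction n using Nat.strong_induction_on with
  | _ n ih =>
    intro a
    rw [X_card_rec, Finset.sum_range_succ, Nat.sub_self, X_card0]
    have : ∀ j ∈ Finset.range n, (X (a + j) (n - j)).ncard = 2 ^ (n - 1 - j) := by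
      intro j hj
      have hj := Finset.mem_range.1 hj
      have e : n - j = (n - 1 - j) + 1 := by omega
      rw [e, ih _ (by omega)]
    rw [Finset.sum_congr rfl this, Finset.sum_range_reflect (fun i => 2 ^ i) n]
    have := Nat.geomSum_eq (m := 2) le_rfl n
    rw [this]
    have : 0 < 2 ^ n := by positivity
    simp; omega

lemma Av_s2 {a j : ℕ} {R : List ℕ} (hR : R ~ List.range' a j) :
    Av (s2 R) ↔ (s2 R).Pairwise (· > ·) := by
  constructor
  · intro h
    rcases j with _ | j
    · have : R = [] := by simpa using hR
      subst this; simp [s2, run2]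
    obtain ⟨P, Q, rfl⟩ := List.append_of_mem (hR.mem_iff.2 (by simp) : a ∈ R)
    rw [mid_min] at hR
    have h0 : ∀ x ∈ P ++ Q, a < x := by
      intro x hx
      have := hR.mem_iff.1 hx
      simp only [List.mem_range'_1] at this
      omega
    rw [s2_split a P Q (fun x hx => h0 x (by simp [hx])) (fun x hx => h0 x (by simp [hx]))] at h ⊢
    have hp : s2 P ++ s2 Q ~ P ++ Q := (s2_perm P).append (s2_perm Q)
    rw [List.pairwise_append]
    refine ⟨?_, by simp, ?_⟩
    · have hn : (s2 P ++ s2 Q).Nodup := (hp.trans hR).nodup_iff.2 List.nodup_range'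
      rw [List.pairwise_iff_forall_sublist]
      intro x y hxy
      have h1 := h x y a (hxy.append (List.Sublist.refl [a]))
      have h2 : x ≠ y := by simpa using hn.sublist hxy
      have h3 := h0 x (hp.mem_iff.1 (hxy.subset (by simp)))
      omega
    · intro x hx y hy
      obtain rfl : y = a := by simpa using hy
      exact h0 x (hp.mem_iff.1 hx)
  · intro h; exact Av_of_pairwise (h.imp le_of_lt)

lemma S_rec (n : ℕ) (τ : List ℕ) : τ ∈ SortSet [1, 2, 3] {0} (n + 1) ↔
    ∃ j ≤ n, ∃ L ∈ X (1 + j) (n - j), ∃ R ∈ D 1 j, τ = L ++ (1 + n) :: R := by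
  simp only [SortSet, Set.mem_setOf_eq, contains231, not_not, IsPermList, sc_eq]
  have key : ∀ L R : List ℕ, L ++ R ~ List.range' 1 n →
    (Av ((run [] (L ++ (1 + n) :: R)).1 ++ (run [] (L ++ (1 + n) :: R)).2) ↔
      ((∀ r ∈ R, ∀ l ∈ L, r < l) ∧ (run [] L).1 = [] ∧ Av (s2 R) ∧ Av (run [] L).2)) := by
    intro L R h
    obtain ⟨k1, k2, k3⟩ := max_key h
    rw [run_split _ _ _ k1 k2]
    have e : (run [] L).1 ++ (run2 [] R).1 ++ ((run2 [] R).2 ++ (1 + n) :: (run [] L).2) =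
      ((run [] L).1 ++ s2 R) ++ (1 + n) :: (run [] L).2 := by simp [s2]
    simp only [e]
    have pL : (run [] L).1 ++ (run [] L).2 ~ L := run_perm [] L
    have nL : ((run [] L).1 ++ (run [] L).2).Nodup :=
      pL.nodup_iff.2 ((h.nodup_iff.2 List.nodup_range').sublist (List.sublist_append_left _ _))
    have m1 : ∀ x ∈ (run [] L).1, x ∈ L := fun x hx => pL.mem_iff.1 (List.mem_append_left _ hx)
    have m2 : ∀ x ∈ (run [] L).2, x ∈ L := fun x hx => pL.mem_iff.1 (List.mem_append_right _ hx)
    have m3 : ∀ x ∈ s2 R, x ∈ R := fun x hx => (s2_perm R).mem_iff.1 hx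
    rw [Av_split]
    · constructor
      · rintro ⟨h1, h2, h3⟩
        have hnil : (run [] L).1 = [] := by
          rw [List.eq_nil_iff_forall_not_mem]
          intro o ho
          obtain ⟨s, hs, hso⟩ := run_low [] L o (by simpa using m1 o ho)
          have := h1 o (List.mem_append_left _ ho) s hs
          omega
        have pL' := run_nil_perm hnil
        refine ⟨?_, hnil, h2.sub (by simp), h3⟩
        intro r hr l hl
        exact h1 r (List.mem_append_right _ ((s2_perm R).mem_iff.2 hr)) l (pL'.mem_iff.2 hl)
      · rintro ⟨h1, h2, h3, h4⟩
        simp only [h2, List.nil_append]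
        exact ⟨fun r hr l hl => h1 r (m3 r hr) l (m2 l hl), h3, h4⟩
    · intro x hx
      rcases List.mem_append.1 hx with hx | hx
      · exact k1 x (m1 x hx)
      · exact k2 x (m3 x hx)
    · exact fun x hx => k1 x (m2 x hx)
    · intro x hx s hs
      rcases List.mem_append.1 hx with hx | hx
      · exact (List.nodup_append.1 nL).2.2 x hx s hs
      · exact (k3 s (m2 s hs) x (m3 x hx)).symm
  constructor
  · rintro ⟨h, hav⟩
    obtain ⟨L, R, rfl⟩ := List.append_of_mem (h.mem_iff.2 (by simp) : (1 + n) ∈ τ)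
    rw [mid_max] at h
    obtain ⟨h1, h2, h3, h4⟩ := (key L R h).1 hav
    obtain ⟨j, hj, hR, hL⟩ := perm_split _ _ L R h h1
    exact ⟨j, hj, L, ⟨hL, h2, h4⟩, R, ⟨hR, (Av_s2 hR).1 h3⟩, rfl⟩
  · rintro ⟨j, hj, L, ⟨hL, hL2, hL3⟩, R, ⟨hR, hR2⟩, rfl⟩
    obtain ⟨h, hlt⟩ := perm_join 1 n j hj L R hR hL
    exact ⟨mid_max.2 h, (key L R h).2 ⟨hlt, hL2, (Av_s2 hR).2 hR2, hL3⟩⟩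

end SC

/-- |Sort_n(sc_{\un{12}3})| = C_{n-1} + ∑_{i=0}^{n-2} 2^{n-2-i} · C_i for n ≥ 1. -/
theorem card_sortingClass_un123 (n : ℕ) (hn : 1 ≤ n) :
    (SortSet [1, 2, 3] {0} n).ncard =
      catalan (n - 1) + ∑ i ∈ Finset.range (n - 1), 2 ^ (n - 2 - i) * catalan i := by
  obtain ⟨n, rfl⟩ : ∃ m, n = m + 1 := ⟨n - 1, by omega⟩
  rw [SC.count _ (fun j => SC.X (1 + j) (n - j)) (fun j => SC.D 1 j) n (1 + n)
        (fun j => SC.fin_perm _ _ _) (fun j => SC.fin_perm _ _ _)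
        (fun j R hR => by simpa using hR.1.length_eq)
        (fun j hj L hL => SC.notMem_of _ _ _ _ hL.1 (by omega))
        (fun j hj L hL => SC.notMem_of _ _ _ _ hL.1 (by omega)) (SC.S_rec n)]
  rw [Finset.sum_range_succ, Nat.sub_self, SC.X_card0, SC.D_card, add_comm, one_mul]
  simp only [Nat.add_sub_cancel]
  congr 1
  refine Finset.sum_congr rfl fun j hj => ?_
  have hj := Finset.mem_range.1 hj
  have e : n - j = (n + 1 - 2 - j) + 1 := by omega
  rw [SC.D_card, e, SC.X_card]
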